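/- arXiv:1507.07837 — 4 statements merged into one kernel-verified Lean document; each statement's English description precedes it below -/
import Mathlib

section
/- Let θ_R < θ_S be real numbers, α > 0, and n > 1. Then the van Genuchten–Mualem water content function θ : ℝ → ℝ is monotonically nondecreasing on ℝ. -/
/-- The van Genuchten–Mualem water content function:
`θ(Ψ) = θR + (θS − θR) * (1 / (1 + (−αΨ)^n))^((n−1)/n)` for `Ψ ≤ 0` and
`θ(Ψ) = θS` for `Ψ > 0`.  Real powers are `Real.rpow`. -/
noncomputable def vanGenuchtenTheta (θR θS α n : ℝ) (Ψ : ℝ) : ℝ :=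
  if Ψ ≤ 0 then θR + (θS - θR) * (1 / (1 + (-(α * Ψ)) ^ n)) ^ ((n - 1) / n)
  else θS

/-- For `θR < θS`, `α > 0` and `n > 1`, the van Genuchten–Mualem water
content function is monotonically nondecreasing on `ℝ`. -/
theorem vanGenuchtenTheta_monotone
    (θR θS α n : ℝ) (hθ : θR < θS) (hα : 0 < α) (hn : 1 < n) :
    Monotone (vanGenuchtenTheta θR θS α n) := by
  have hexp : 0 ≤ (n - 1) / n := div_nonneg (by linarith) (by linarith)
  intro x y hxy
  simp only [vanGenuchtenTheta]
  by_cases hx : x ≤ 0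
  · have hux : 0 ≤ -(α * x) := by nlinarith
    have hpx : 0 ≤ (-(α * x)) ^ n := Real.rpow_nonneg hux n
    by_cases hy : y ≤ 0
    · have huy : 0 ≤ -(α * y) := by nlinarith
      have hpy : 0 ≤ (-(α * y)) ^ n := Real.rpow_nonneg huy n
      have hpow : (-(α * y)) ^ n ≤ (-(α * x)) ^ n :=
        Real.rpow_le_rpow huy (by nlinarith) (by linarith)
      have hle : (1 / (1 + (-(α * x)) ^ n)) ^ ((n - 1) / n) ≤
          (1 / (1 + (-(α * y)) ^ n)) ^ ((n - 1) / n) :=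
        Real.rpow_le_rpow (by positivity)
          (one_div_le_one_div_of_le (by linarith) (by linarith)) hexp
      rw [if_pos hx, if_pos hy]
      nlinarith
    · have hle : (1 / (1 + (-(α * x)) ^ n)) ^ ((n - 1) / n) ≤ 1 :=
        Real.rpow_le_one (by positivity)
          ((div_le_one (by linarith)).2 (by linarith)) hexp
      rw [if_pos hx, if_neg hy]
      nlinarith
  · rw [if_neg hx, if_neg fun hy => hx (hxy.trans hy)]
end

section
/- Let θ_R < θ_S be real numbers, α > 0, and n > 1. Then the van Genuchten–Mualem water content function θ : ℝ → ℝ is continuous on all of ℝ, and satisfies θ_R < θ(Ψ) ≤ θ_S for every Ψ ∈ ℝ; moreover θ(Ψ) → θ_R as Ψ → −∞. -/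
theorem vanGenuchtenTheta_eq_max (θR θS : ℝ) {α n : ℝ} (hα : 0 < α) (hn : n ≠ 0) (Ψ : ℝ) :
    vanGenuchtenTheta θR θS α n Ψ =
      θR + (θS - θR) * (1 / (1 + max 0 (-(α * Ψ)) ^ n)) ^ ((n - 1) / n) := by
  unfold vanGenuchtenTheta
  split_ifs with h
  · rw [max_eq_right (by nlinarith)]
  · rw [max_eq_left (by nlinarith), Real.zero_rpow hn]
    simp

/-- For `θR < θS`, `α > 0` and `n > 1`, the van Genuchten–Mualem water
content function is continuous on all of `ℝ`, satisfies
`θR < θ(Ψ) ≤ θS` for every `Ψ`, and tends to `θR` as `Ψ → −∞`. -/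
theorem vanGenuchtenTheta_continuous_bounds_limit
    (θR θS α n : ℝ) (hθ : θR < θS) (hα : 0 < α) (hn : 1 < n) :
    Continuous (vanGenuchtenTheta θR θS α n) ∧
      (∀ Ψ : ℝ, θR < vanGenuchtenTheta θR θS α n Ψ ∧ vanGenuchtenTheta θR θS α n Ψ ≤ θS) ∧
      Filter.Tendsto (vanGenuchtenTheta θR θS α n) Filter.atBot (nhds θR) := by
  have hn0 : 0 < n := by linarith
  have hm : 0 < (n - 1) / n := div_pos (by linarith) hn0
  have hpos (Ψ : ℝ) : 0 ≤ max 0 (-(α * Ψ)) ^ n := Real.rpow_nonneg (le_max_left _ _) _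
  rw [funext (vanGenuchtenTheta_eq_max θR θS hα hn0.ne')]
  refine ⟨?_, fun Ψ => ⟨?_, ?_⟩, ?_⟩
  · have hpow : Continuous fun Ψ : ℝ => max 0 (-(α * Ψ)) ^ n :=
      (by fun_prop : Continuous fun Ψ : ℝ => max 0 (-(α * Ψ))).rpow_const
        fun _ => Or.inr hn0.le
    have hbase : Continuous fun Ψ : ℝ => 1 / (1 + max 0 (-(α * Ψ)) ^ n) :=
      continuous_const.div (continuous_const.add hpow) fun Ψ => by linarith [hpos Ψ]
    exact continuous_const.add
      (continuous_const.mul (hbase.rpow_const fun _ => Or.inr hm.le))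
  · have hden : 0 < 1 / (1 + max 0 (-(α * Ψ)) ^ n) := by
      have := hpos Ψ
      positivity
    linarith [mul_pos (sub_pos.2 hθ) (Real.rpow_pos_of_pos hden ((n - 1) / n))]
  · have hle : (1 / (1 + max 0 (-(α * Ψ)) ^ n)) ^ ((n - 1) / n) ≤ 1 := by
      have := hpos Ψ
      refine Real.rpow_le_one (by positivity) ?_ hm.le
      rw [div_le_one (by positivity)]
      linarith
    linarith [mul_le_of_le_one_right (sub_pos.2 hθ).le hle]
  · have hmax : Filter.Tendsto (fun Ψ : ℝ => max 0 (-(α * Ψ))) Filter.atBot Filter.atTop :=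
      Filter.tendsto_atTop_mono (fun _ => le_max_right _ _)
        (Filter.tendsto_neg_atBot_atTop.comp (Filter.tendsto_id.const_mul_atBot hα))
    have hbase : Filter.Tendsto (fun Ψ : ℝ => 1 / (1 + max 0 (-(α * Ψ)) ^ n))
        Filter.atBot (nhds 0) :=
      (Filter.tendsto_atTop_add_const_left _ 1
        ((tendsto_rpow_atTop hn0).comp hmax)).const_div_atTop 1
    have hpow := hbase.rpow_const (p := (n - 1) / n) (Or.inr hm.le)
    rw [Real.zero_rpow hm.ne'] at hpow
    simpa using (hpow.const_mul (θS - θR)).const_add θR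
end

section
/- Let θ_R < θ_S be real numbers, α > 0, and n > 2. Then the van Genuchten–Mualem water content function θ : ℝ → ℝ is Lipschitz continuous on ℝ, i.e. there exists a constant L_θ < ∞ with |θ(Ψ₁) − θ(Ψ₂)| ≤ L_θ|Ψ₁ − Ψ₂| for all Ψ₁, Ψ₂ ∈ ℝ. -/
theorem hasDerivAt_one_add_rpow_rpow_neg {n m t : ℝ} (hn : 1 ≤ n) (ht : 0 ≤ t) :
    HasDerivAt (fun x : ℝ => (1 + x ^ n) ^ (-m))
      (n * t ^ (n - 1) * (-m) * (1 + t ^ n) ^ (-m - 1)) t := by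
  have h : HasDerivAt (fun x : ℝ => 1 + x ^ n) (n * t ^ (n - 1)) t :=
    (Real.hasDerivAt_rpow_const (Or.inr hn)).const_add 1
  exact h.rpow_const (Or.inl (by positivity))

theorem abs_one_add_rpow_rpow_neg_sub_le {n s t : ℝ} (hn : 1 ≤ n) (hs : 0 ≤ s) (ht : 0 ≤ t) :
    |(1 + s ^ n) ^ (-((n - 1) / n)) - (1 + t ^ n) ^ (-((n - 1) / n))| ≤ (n - 1) * |s - t| := by
  have hn0 : 0 < n := by linarith
  have hm : 0 ≤ (n - 1) / n := div_nonneg (by linarith) hn0.le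
  refine (convex_Ici (0 : ℝ)).norm_image_sub_le_of_norm_hasDerivWithin_le
    (f := fun x : ℝ => (1 + x ^ n) ^ (-((n - 1) / n)))
    (fun x hx => (hasDerivAt_one_add_rpow_rpow_neg hn hx).hasDerivWithinAt) ?_ ht hs
  intro x hx
  have hx0 : 0 ≤ x := hx
  have hxn : 0 ≤ x ^ n := Real.rpow_nonneg hx0 n
  have hpow : x ^ (n - 1) ≤ (1 + x ^ n) ^ ((n - 1) / n + 1) :=
    calc x ^ (n - 1) = (x ^ n) ^ ((n - 1) / n) := by
          rw [← Real.rpow_mul hx0, mul_div_cancel₀ _ hn0.ne']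
      _ ≤ (1 + x ^ n) ^ ((n - 1) / n) := Real.rpow_le_rpow hxn (by linarith) hm
      _ ≤ (1 + x ^ n) ^ ((n - 1) / n + 1) :=
          Real.rpow_le_rpow_of_exponent_le (by linarith) (by linarith)
  have hprod : x ^ (n - 1) * (1 + x ^ n) ^ (-((n - 1) / n) - 1) ≤ 1 := by
    rw [show -((n - 1) / n) - 1 = -((n - 1) / n + 1) by ring, Real.rpow_neg (by linarith),
      ← div_eq_mul_inv]
    exact (div_le_one (by positivity)).2 hpow
  have hval : n * x ^ (n - 1) * (-((n - 1) / n)) * (1 + x ^ n) ^ (-((n - 1) / n) - 1)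
      = -((n - 1) * (x ^ (n - 1) * (1 + x ^ n) ^ (-((n - 1) / n) - 1))) := by
    field_simp
  have hn1 : 0 ≤ n - 1 := by linarith
  rw [hval, norm_neg, Real.norm_of_nonneg (by positivity)]
  exact mul_le_of_le_one_right hn1 hprod

theorem vanGenuchtenTheta_eq {θR θS α n : ℝ} (hα : 0 < α) (hn : 0 < n) (Ψ : ℝ) :
    vanGenuchtenTheta θR θS α n Ψ
      = θR + (θS - θR) * (1 + (max (-(α * Ψ)) 0) ^ n) ^ (-((n - 1) / n)) := by
  unfold vanGenuchtenTheta
  split_ifs with h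
  · have h0 : 0 ≤ -(α * Ψ) := by nlinarith
    have h1 : 0 ≤ 1 + (-(α * Ψ)) ^ n := by positivity
    rw [max_eq_left h0, one_div, Real.inv_rpow h1, Real.rpow_neg h1]
  · have h0 : -(α * Ψ) ≤ 0 := by nlinarith
    simp [max_eq_right h0, Real.zero_rpow hn.ne']

/-- For `θR < θS`, `α > 0` and `n > 2`, the van Genuchten–Mualem water
content function is Lipschitz continuous on `ℝ`: there is a constant
`Lθ` with `|θ(Ψ₁) − θ(Ψ₂)| ≤ Lθ |Ψ₁ − Ψ₂|` for all `Ψ₁, Ψ₂`. -/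
theorem vanGenuchtenTheta_lipschitz
    (θR θS α n : ℝ) (hθ : θR < θS) (hα : 0 < α) (hn : 2 < n) :
    ∃ Lθ : ℝ, ∀ Ψ₁ Ψ₂ : ℝ,
      |vanGenuchtenTheta θR θS α n Ψ₁ - vanGenuchtenTheta θR θS α n Ψ₂|
        ≤ Lθ * |Ψ₁ - Ψ₂| := by
  refine ⟨(θS - θR) * ((n - 1) * α), fun Ψ₁ Ψ₂ => ?_⟩
  have hd : 0 ≤ θS - θR := by linarith
  have hn1 : 0 ≤ n - 1 := by linarith
  have hmax : |max (-(α * Ψ₁)) 0 - max (-(α * Ψ₂)) 0| ≤ α * |Ψ₁ - Ψ₂| := by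
    refine (abs_max_sub_max_le_abs _ _ _).trans_eq ?_
    rw [show -(α * Ψ₁) - -(α * Ψ₂) = -(α * (Ψ₁ - Ψ₂)) by ring, abs_neg, abs_mul, abs_of_pos hα]
  rw [vanGenuchtenTheta_eq hα (by linarith), vanGenuchtenTheta_eq hα (by linarith),
    add_sub_add_left_eq_sub, ← mul_sub, abs_mul, abs_of_nonneg hd, mul_assoc, mul_assoc]
  gcongr
  refine (abs_one_add_rpow_rpow_neg_sub_le (by linarith) (le_max_right _ _)
    (le_max_right _ _)).trans ?_
  gcongr
end

section
/- Let 0 < θ_R < θ_S ≤ 1, α > 0, n > 1, and K_S > 0. Then the van Genuchten–Mualem hydraulic conductivity function K : ℝ → ℝ satisfies 0 < K(Ψ) ≤ K_S for every Ψ ∈ ℝ. -/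
/-- The van Genuchten–Mualem hydraulic conductivity function:
`K(Ψ) = KS * θ(Ψ)^(1/2) * (1 − (1 − θ(Ψ)^(n/(n−1)))^((n−1)/n))²` for `Ψ ≤ 0`
and `K(Ψ) = KS` for `Ψ > 0`.  Real powers are `Real.rpow`. -/
noncomputable def vanGenuchtenK (θR θS α n KS : ℝ) (Ψ : ℝ) : ℝ :=
  if Ψ ≤ 0 then
    KS * (vanGenuchtenTheta θR θS α n Ψ) ^ ((1 : ℝ) / 2) *
      (1 - (1 - (vanGenuchtenTheta θR θS α n Ψ) ^ (n / (n - 1))) ^ ((n - 1) / n)) ^ 2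
  else KS

theorem vanGenuchtenTheta_pos {θR θS α n Ψ : ℝ} (hθR : 0 < θR) (hθ : θR < θS)
    (hα : 0 ≤ α) : 0 < vanGenuchtenTheta θR θS α n Ψ := by
  unfold vanGenuchtenTheta
  split_ifs with hΨ
  · have hx : 0 ≤ -(α * Ψ) := neg_nonneg.2 (mul_nonpos_of_nonneg_of_nonpos hα hΨ)
    have hd : 0 ≤ θS - θR := (sub_pos.2 hθ).le
    positivity
  · exact hθR.trans hθ

theorem vanGenuchtenTheta_le {θR θS α n Ψ : ℝ} (hθ : θR < θS) (hα : 0 ≤ α) (hn : 1 < n) :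
    vanGenuchtenTheta θR θS α n Ψ ≤ θS := by
  unfold vanGenuchtenTheta
  split_ifs with hΨ
  · have hx : 0 ≤ (-(α * Ψ)) ^ n :=
      Real.rpow_nonneg (neg_nonneg.2 (mul_nonpos_of_nonneg_of_nonpos hα hΨ)) n
    have hs : (1 / (1 + (-(α * Ψ)) ^ n)) ^ ((n - 1) / n) ≤ 1 := by
      refine Real.rpow_le_one (by positivity) ?_ (div_nonneg (by linarith) (by linarith))
      rw [div_le_one (by positivity)]
      linarith
    linarith [mul_le_of_le_one_right (sub_pos.2 hθ).le hs]
  · exact le_rfl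

/-- The Mualem relative conductivity takes values in `(0, 1]` on `(0, 1]`. -/
theorem mualem_mem_Ioc {t p q : ℝ} (ht : t ∈ Set.Ioc (0 : ℝ) 1) (hp : 0 ≤ p) (hq : 0 < q) :
    t ^ ((1 : ℝ) / 2) * (1 - (1 - t ^ p) ^ q) ^ 2 ∈ Set.Ioc (0 : ℝ) 1 := by
  obtain ⟨ht0, ht1⟩ := ht
  have hp0 : 0 < t ^ p := Real.rpow_pos_of_pos ht0 p
  have hp1 : t ^ p ≤ 1 := Real.rpow_le_one ht0.le ht1 hp
  have hq0 : 0 ≤ (1 - t ^ p) ^ q := Real.rpow_nonneg (by linarith) q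
  have hq1 : (1 - t ^ p) ^ q < 1 := Real.rpow_lt_one (by linarith) (by linarith) hq
  have hu : 0 < 1 - (1 - t ^ p) ^ q := sub_pos.2 hq1
  exact ⟨by positivity, mul_le_one₀ (Real.rpow_le_one ht0.le ht1 (by norm_num)) (sq_nonneg _)
    (pow_le_one₀ hu.le (by linarith))⟩

/-- For `0 < θR < θS ≤ 1`, `α > 0`, `n > 1` and `KS > 0`, the van
Genuchten–Mualem hydraulic conductivity function satisfies
`0 < K(Ψ) ≤ KS` for every `Ψ ∈ ℝ`. -/
theorem vanGenuchtenK_bounds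
    (θR θS α n KS : ℝ) (hθR : 0 < θR) (hθ : θR < θS) (hθS : θS ≤ 1)
    (hα : 0 < α) (hn : 1 < n) (hKS : 0 < KS) :
    ∀ Ψ : ℝ, 0 < vanGenuchtenK θR θS α n KS Ψ ∧ vanGenuchtenK θR θS α n KS Ψ ≤ KS := by
  intro Ψ
  unfold vanGenuchtenK
  split_ifs
  · have hn' : 0 < n - 1 := sub_pos.2 hn
    have hn0 : 0 < n := one_pos.trans hn
    obtain ⟨h0, h1⟩ := mualem_mem_Ioc
      (t := vanGenuchtenTheta θR θS α n Ψ) (p := n / (n - 1)) (q := (n - 1) / n)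
      ⟨vanGenuchtenTheta_pos hθR hθ hα.le, (vanGenuchtenTheta_le hθ hα.le hn).trans hθS⟩
      (div_pos hn0 hn').le (div_pos hn' hn0)
    rw [mul_assoc]
    exact ⟨mul_pos hKS h0, mul_le_of_le_one_right hKS.le h1⟩
  · exact ⟨hKS, le_rfl⟩
end
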